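/- Let (A,≺,≻) be a pre-anti-flexible algebra over a field F of characteristic 0 and r≺, r≻ ∈ A⊗A. Define Δ≻(x) := (id⊗L·(x))r≻ + (R≺(x)⊗id)σr≺ and Δ≺(x) := (id⊗L≻(x))r≺ + (R·(x)⊗id)σr≻ for x ∈ A. Then the identity Δ≻(x·y) − (R≺(y)⊗id)Δ≻(x) − (id⊗L·(x))Δ≻(y) = σ(id⊗L≻(y))Δ≺(x) + σ(R·(x)⊗id)Δ≺(y) − σΔ≺(y·x) holds for all x, y ∈ A if and only if (R≺(y)⊗L·(x) + L≻(y)⊗R·(x))(r≻ + σr≺) = 0 for all x, y ∈ A. -/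

import Mathlib

open TensorProduct

/-- Pre-anti-flexible algebra structure on a pair of bilinear products `(≺, ≻) = (p, s)`. -/
def IsPreAntiFlexible {F A : Type*} [Field F] [AddCommGroup A] [Module F A]
    (p s : A →ₗ[F] A →ₗ[F] A) : Prop :=
  (∀ x y z : A, p (s x y) z - s x (p y z) = p (s z y) x - s z (p y x)) ∧
  (∀ x y z : A, s (p x y + s x y) z - s x (s y z) = p (p z y) x - p z (p y x + s y x))

/-- The flip `σ` on `A ⊗ A`. -/
noncomputable def sigmaTensor (F A : Type*) [Field F] [AddCommGroup A] [Module F A] :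
    A ⊗[F] A →ₗ[F] A ⊗[F] A := (TensorProduct.comm F A A).toLinearMap

/-- `Δ≻(x) = (id ⊗ L·(x)) r≻ + (R≺(x) ⊗ id) σ r≺`, where `L·(x) = p x + s x` and
`R≺(x) = p.flip x`. -/
noncomputable def cobSucc {F A : Type*} [Field F] [AddCommGroup A] [Module F A]
    (p s : A →ₗ[F] A →ₗ[F] A) (rp rs : A ⊗[F] A) (x : A) : A ⊗[F] A :=
  TensorProduct.map LinearMap.id (p x + s x) rs
    + TensorProduct.map (p.flip x) LinearMap.id (sigmaTensor F A rp)

/-- `Δ≺(x) = (id ⊗ L≻(x)) r≺ + (R·(x) ⊗ id) σ r≻`, where `L≻(x) = s x` and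
`R·(x) = p.flip x + s.flip x`. -/
noncomputable def cobPrec {F A : Type*} [Field F] [AddCommGroup A] [Module F A]
    (p s : A →ₗ[F] A →ₗ[F] A) (rp rs : A ⊗[F] A) (x : A) : A ⊗[F] A :=
  TensorProduct.map LinearMap.id (s x) rp
    + TensorProduct.map (p.flip x + s.flip x) LinearMap.id (sigmaTensor F A rs)

/-- The associator of `x · y = x ≺ y + x ≻ y` is symmetric in its outer arguments. -/
lemma IsPreAntiFlexible.antiflexible {F A : Type*} [Field F] [AddCommGroup A] [Module F A]
    {p s : A →ₗ[F] A →ₗ[F] A} (hA : IsPreAntiFlexible p s) (x y z : A) :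
    (p + s) ((p + s) x y) z - (p + s) x ((p + s) y z)
      = (p + s) ((p + s) z y) x - (p + s) z ((p + s) y x) := by
  have h₁ := hA.1 x y z
  have h₂ := hA.2 x y z
  have h₃ := hA.2 z y x
  simp only [LinearMap.add_apply, map_add] at *
  linear_combination (norm := module) h₁ + h₂ - h₃

/-- The part of the coboundary identity that involves `r≻`. -/
lemma IsPreAntiFlexible.coboundary_succ_part {F A : Type*} [Field F] [AddCommGroup A]
    [Module F A] {p s : A →ₗ[F] A →ₗ[F] A} (hA : IsPreAntiFlexible p s) (r : A ⊗[F] A) (x y : A) :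
    TensorProduct.map LinearMap.id (p (p x y + s x y) + s (p x y + s x y)) r
        - TensorProduct.map (p.flip y) LinearMap.id (TensorProduct.map LinearMap.id (p x + s x) r)
        - TensorProduct.map LinearMap.id (p x + s x) (TensorProduct.map LinearMap.id (p y + s y) r)
        - sigmaTensor F A (TensorProduct.map LinearMap.id (s y)
            (TensorProduct.map (p.flip x + s.flip x) LinearMap.id (sigmaTensor F A r)))
        - sigmaTensor F A (TensorProduct.map (p.flip x + s.flip x) LinearMap.id
            (TensorProduct.map (p.flip y + s.flip y) LinearMap.id (sigmaTensor F A r)))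
        + sigmaTensor F A (TensorProduct.map (p.flip (p y x + s y x) + s.flip (p y x + s y x))
            LinearMap.id (sigmaTensor F A r))
      = -(TensorProduct.map (p.flip y) (p x + s x) r
          + TensorProduct.map (s y) (p.flip x + s.flip x) r) := by
  induction r with
  | zero => simp
  | add r t hr ht =>
    simp only [map_add] at *
    linear_combination (norm := module) hr + ht
  | tmul a b =>
    have h := congrArg (a ⊗ₜ[F] ·) (hA.antiflexible x y b)
    simp only [sigmaTensor, LinearEquiv.coe_coe, TensorProduct.comm_tmul, TensorProduct.map_tmul,
      LinearMap.id_apply, LinearMap.add_apply, LinearMap.flip_apply, map_add,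
      TensorProduct.tmul_add, TensorProduct.tmul_sub] at *
    linear_combination (norm := module) h

/-- The part of the coboundary identity that involves `r≺`. -/
lemma IsPreAntiFlexible.coboundary_prec_part {F A : Type*} [Field F] [AddCommGroup A]
    [Module F A] {p s : A →ₗ[F] A →ₗ[F] A} (hA : IsPreAntiFlexible p s) (r : A ⊗[F] A) (x y : A) :
    TensorProduct.map (p.flip (p x y + s x y)) LinearMap.id (sigmaTensor F A r)
        - TensorProduct.map (p.flip y) LinearMap.id
            (TensorProduct.map (p.flip x) LinearMap.id (sigmaTensor F A r))
        - TensorProduct.map LinearMap.id (p x + s x)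
            (TensorProduct.map (p.flip y) LinearMap.id (sigmaTensor F A r))
        - sigmaTensor F A (TensorProduct.map LinearMap.id (s y)
            (TensorProduct.map LinearMap.id (s x) r))
        - sigmaTensor F A (TensorProduct.map (p.flip x + s.flip x) LinearMap.id
            (TensorProduct.map LinearMap.id (s y) r))
        + sigmaTensor F A (TensorProduct.map LinearMap.id (s (p y x + s y x)) r)
      = -(TensorProduct.map (p.flip y) (p x + s x) (sigmaTensor F A r)
          + TensorProduct.map (s y) (p.flip x + s.flip x) (sigmaTensor F A r)) := by
  induction r with
  | zero => simp
  | add r t hr ht =>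
    simp only [map_add] at *
    linear_combination (norm := module) hr + ht
  | tmul c d =>
    have h := congrArg (· ⊗ₜ[F] c) (hA.2 y x d)
    simp only [sigmaTensor, LinearEquiv.coe_coe, TensorProduct.comm_tmul, TensorProduct.map_tmul,
      LinearMap.id_apply, LinearMap.add_apply, LinearMap.flip_apply, map_add,
      TensorProduct.tmul_add, TensorProduct.add_tmul, TensorProduct.sub_tmul] at *
    linear_combination (norm := module) h

/-- the first coboundary compatibility identity for `Δ≺, Δ≻` holds iff
`(R≺(y) ⊗ L·(x) + L≻(y) ⊗ R·(x))(r≻ + σ r≺) = 0` for all `x, y`. -/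
theorem coboundary_eq1_iff
    {F A : Type*} [Field F] [CharZero F] [AddCommGroup A] [Module F A]
    (p s : A →ₗ[F] A →ₗ[F] A) (hA : IsPreAntiFlexible p s) (rp rs : A ⊗[F] A) :
    (∀ x y : A,
      cobSucc p s rp rs (p x y + s x y)
          - TensorProduct.map (p.flip y) LinearMap.id (cobSucc p s rp rs x)
          - TensorProduct.map LinearMap.id (p x + s x) (cobSucc p s rp rs y)
        = sigmaTensor F A (TensorProduct.map LinearMap.id (s y) (cobPrec p s rp rs x))
          + sigmaTensor F A
              (TensorProduct.map (p.flip x + s.flip x) LinearMap.id (cobPrec p s rp rs y))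
          - sigmaTensor F A (cobPrec p s rp rs (p y x + s y x))) ↔
    (∀ x y : A,
      TensorProduct.map (p.flip y) (p x + s x) (rs + sigmaTensor F A rp)
        + TensorProduct.map (s y) (p.flip x + s.flip x) (rs + sigmaTensor F A rp) = 0) := by
  refine forall₂_congr fun x y => ?_
  rw [← sub_eq_zero, ← neg_eq_zero (a := TensorProduct.map (p.flip y) (p x + s x) _ + _)]
  refine Eq.congr_left ?_
  have h₁ := hA.coboundary_succ_part rs x y
  have h₂ := hA.coboundary_prec_part rp x y
  simp only [cobSucc, cobPrec, (TensorProduct.map _ _).map_add, (sigmaTensor F A).map_add]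
  linear_combination (norm := module) h₁ + h₂
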